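/- Let F be the free Lie algebra over a field K of characteristic zero on two generators x₁, x₂, and let R be the Lie ideal of F generated by the element ⁅⁅x₁, x₂⁆, x₂⁆ together with F⁴, the fourth term of the lower central series of F (so that F/R is the Lie algebra L₄,₃ with presentation ⁅x₁,x₂⁆ = x₃, ⁅x₁,x₃⁆ = x₄). Then the quotient (R ∩ F³)/⁅⁅R, F⁆, F⁆, which is the 2-nilpotent multiplier of L₄,₃, is an abelian Lie algebra of dimension 6. -/

import Mathlib

universe u v

/-- The 2-nilpotent multiplier `(R ∩ F³) / ⁅⁅R, F⁆, F⁆` associated to a Lie ideal `R` of a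
Lie algebra `F` (intended: `F` a free Lie algebra and `F/R ≅ L` a free presentation of `L`).
Here `F³ = LieModule.lowerCentralSeries K F F 2` is the third term of the lower central
series of `F` (indexing in Mathlib starts at `0` with `F¹ = F`). -/
abbrev twoNilpotentMultiplier (K F : Type*) [Field K] [LieRing F] [LieAlgebra K F]
    (R : LieIdeal K F) : Type _ :=
  (↥((R ⊓ LieModule.lowerCentralSeries K F F 2 : LieIdeal K F) : Submodule K F)) ⧸
    (Submodule.comap
      ((R ⊓ LieModule.lowerCentralSeries K F F 2 : LieIdeal K F) : Submodule K F).subtype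
      ((⁅⁅R, (⊤ : LieIdeal K F)⁆, (⊤ : LieIdeal K F)⁆ : LieIdeal K F) : Submodule K F))

namespace TwoNil

/-- The ten-dimensional Lie algebra `F / ⁅⁅R, F⁆, F⁆`, as a coordinate space.
Basis: `a, b, c = [a,b], d = [a,c], r = [b,c], p = [a,d], q = [b,d], s = [b,r], t = [a,p],
u = [b,p]`. -/
def Q (K : Type*) := Fin 10 → K

variable {K : Type*} [Field K]

noncomputable instance : AddCommGroup (Q K) := inferInstanceAs (AddCommGroup (Fin 10 → K))
noncomputable instance : Module K (Q K) := inferInstanceAs (Module K (Fin 10 → K))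

/-- basis vectors -/
def bv (i : Fin 10) : Q K := fun j => if j = i then 1 else 0

theorem bv_apply (i j : Fin 10) : (bv i : Q K) j = if j = i then 1 else 0 := rfl

/-- antisymmetric minor -/
def m (x y : Q K) (i j : Fin 10) : K := x i * y j - x j * y i

/-- The bracket on `Q K`. -/
def br (x y : Q K) : Q K :=
  ![0, 0, m x y 0 1, m x y 0 2, m x y 1 2, m x y 0 3, m x y 1 3 + m x y 0 4, m x y 1 4,
    m x y 0 5, m x y 1 5 - m x y 2 3]

theorem Q_add (x y : Q K) (i : Fin 10) : (x + y) i = x i + y i := rfl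
theorem Q_smul (k : K) (y : Q K) (i : Fin 10) : (k • y) i = k * y i := rfl
theorem Q_zero (i : Fin 10) : (0 : Q K) i = 0 := rfl

theorem br0 (x y : Q K) : br x y 0 = 0 := rfl
theorem br1 (x y : Q K) : br x y 1 = 0 := rfl
theorem br2 (x y : Q K) : br x y 2 = x 0 * y 1 - x 1 * y 0 := rfl
theorem br3 (x y : Q K) : br x y 3 = x 0 * y 2 - x 2 * y 0 := rfl
theorem br4 (x y : Q K) : br x y 4 = x 1 * y 2 - x 2 * y 1 := rfl
theorem br5 (x y : Q K) : br x y 5 = x 0 * y 3 - x 3 * y 0 := rfl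
theorem br6 (x y : Q K) : br x y 6 = (x 1 * y 3 - x 3 * y 1) + (x 0 * y 4 - x 4 * y 0) := rfl
theorem br7 (x y : Q K) : br x y 7 = x 1 * y 4 - x 4 * y 1 := rfl
theorem br8 (x y : Q K) : br x y 8 = x 0 * y 5 - x 5 * y 0 := rfl
theorem br9 (x y : Q K) : br x y 9 = (x 1 * y 5 - x 5 * y 1) - (x 2 * y 3 - x 3 * y 2) := rfl

theorem Q_ext {x y : Q K} (h0 : x 0 = y 0) (h1 : x 1 = y 1) (h2 : x 2 = y 2) (h3 : x 3 = y 3)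
    (h4 : x 4 = y 4) (h5 : x 5 = y 5) (h6 : x 6 = y 6) (h7 : x 7 = y 7) (h8 : x 8 = y 8)
    (h9 : x 9 = y 9) : x = y := by
  funext i
  fin_cases i <;> assumption

noncomputable instance : LieRing (Q K) where
  bracket := br
  add_lie x y z := by
    apply Q_ext <;> simp only [Q_add, br0, br1, br2, br3, br4, br5, br6, br7, br8, br9] <;> ring
  lie_add x y z := by
    apply Q_ext <;> simp only [Q_add, br0, br1, br2, br3, br4, br5, br6, br7, br8, br9] <;> ring
  lie_self x := by
    apply Q_ext <;> simp only [Q_zero, br0, br1, br2, br3, br4, br5, br6, br7, br8, br9] <;> ring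
  leibniz_lie x y z := by
    apply Q_ext <;> simp only [Q_add, br0, br1, br2, br3, br4, br5, br6, br7, br8, br9] <;> ring

noncomputable instance : LieAlgebra K (Q K) where
  lie_smul k x y := by
    change br _ _ = k • br _ _
    apply Q_ext <;> simp only [Q_smul, br0, br1, br2, br3, br4, br5, br6, br7, br8, br9] <;> ring

theorem lie_eq (x y : Q K) : ⁅x, y⁆ = br x y := rfl

/-- first `n` coordinates vanish -/
def J (n : ℕ) : Submodule K (Q K) where
  carrier := {x | ∀ i : Fin 10, i.val < n → x i = 0}
  add_mem' {x y} hx hy i hi := by rw [Q_add, hx i hi, hy i hi, add_zero]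
  zero_mem' i _ := rfl
  smul_mem' k x hx i hi := by rw [Q_smul, hx i hi, mul_zero]

theorem lie_J2 (x y : Q K) : ⁅x, y⁆ ∈ J (K := K) 2 := by
  intro i hi
  rw [lie_eq]
  fin_cases i <;> first | rfl | (exfalso; simp at hi)

theorem lie_J3 (x y : Q K) (h : y ∈ J (K := K) 2) : ⁅x, y⁆ ∈ J (K := K) 3 := by
  have h0 : y 0 = 0 := h 0 (by decide)
  have h1 : y 1 = 0 := h 1 (by decide)
  intro i hi
  rw [lie_eq]
  fin_cases i <;> first | rfl | (exfalso; simp at hi; done) | skip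
  change br x y 2 = 0
  rw [br2, h0, h1]; ring

/-- The ideal of vectors whose first four coordinates vanish. -/
def I : LieIdeal K (Q K) where
  toSubmodule := J 4
  lie_mem {x y} h := by
    have h0 : y 0 = 0 := h 0 (by decide)
    have h1 : y 1 = 0 := h 1 (by decide)
    have h2 : y 2 = 0 := h 2 (by decide)
    intro i hi
    rw [lie_eq]
    fin_cases i <;> first | rfl | (exfalso; simp at hi; done) | skip
    · change br x y 2 = 0
      rw [br2, h0, h1]; ring
    · change br x y 3 = 0
      rw [br3, h0, h2]; ring

theorem lie_J4 (x y : Q K) (h : y ∈ J (K := K) 3) : ⁅x, y⁆ ∈ J (K := K) 4 := by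
  have h0 : y 0 = 0 := h 0 (by decide)
  have h1 : y 1 = 0 := h 1 (by decide)
  have h2 : y 2 = 0 := h 2 (by decide)
  intro i hi
  rw [lie_eq]
  fin_cases i <;> first | rfl | (exfalso; simp at hi; done) | skip
  · change br x y 2 = 0
    rw [br2, h0, h1]; ring
  · change br x y 3 = 0
    rw [br3, h0, h2]; ring

theorem lie_lie_I (x y z : Q K) (h : z ∈ J (K := K) 4) : ⁅x, ⁅y, z⁆⁆ = 0 := by
  have h0 : z 0 = 0 := h 0 (by decide)
  have h1 : z 1 = 0 := h 1 (by decide)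
  have h2 : z 2 = 0 := h 2 (by decide)
  have h3 : z 3 = 0 := h 3 (by decide)
  rw [lie_eq, lie_eq]
  apply Q_ext <;> simp only [Q_zero, br0, br1, br2, br3, br4, br5, br6, br7, br8, br9, h0, h1, h2,
    h3] <;> ring

section
variable {F : Type*} [LieRing F] [LieAlgebra K F]

theorem lie_sub_le (A B : LieIdeal K F) (P : Submodule K F)
    (h : ∀ x ∈ A, ∀ y ∈ B, ⁅x, y⁆ ∈ P) : ∀ z ∈ ⁅A, B⁆, z ∈ P := by
  intro z hz
  have : (⁅A, B⁆ : LieIdeal K F).toSubmodule ≤ P := by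
    rw [LieSubmodule.lieIdeal_oper_eq_linear_span', Submodule.span_le]
    rintro _ ⟨x, hx, y, hy, rfl⟩
    exact h x hx y hy
  exact this hz

theorem lcs_step (k : ℕ) (P P' : Submodule K F)
    (hk : ∀ z ∈ LieModule.lowerCentralSeries K F F k, z ∈ P)
    (h : ∀ x : F, ∀ y ∈ P, ⁅x, y⁆ ∈ P') :
    ∀ z ∈ LieModule.lowerCentralSeries K F F (k + 1), z ∈ P' := by
  intro z hz
  rw [LieModule.lowerCentralSeries_succ] at hz
  exact lie_sub_le _ _ P' (fun x _ y hy => h x y (hk y hy)) z hz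

theorem lie_mem_lcs (k : ℕ) (x y : F) (hy : y ∈ LieModule.lowerCentralSeries K F F k) :
    ⁅x, y⁆ ∈ LieModule.lowerCentralSeries K F F (k + 1) := by
  rw [LieModule.lowerCentralSeries_succ]
  exact LieSubmodule.lie_mem_lie trivial hy

/-- `⁅⁅R, F⁆, F⁆` -/
abbrev S (R : LieIdeal K F) : LieIdeal K F := ⁅⁅R, (⊤ : LieIdeal K F)⁆, (⊤ : LieIdeal K F)⁆

theorem lie_lie_mem_S (R : LieIdeal K F) (x y z : F) (hz : z ∈ R) : ⁅x, ⁅y, z⁆⁆ ∈ S R := by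
  rw [S, LieSubmodule.lie_comm, LieSubmodule.lie_comm R]
  exact LieSubmodule.lie_mem_lie trivial (LieSubmodule.lie_mem_lie trivial hz)

theorem S_le (R : LieIdeal K F) (P : Submodule K F)
    (h : ∀ x y : F, ∀ z ∈ R, ⁅x, ⁅y, z⁆⁆ ∈ P) : ∀ z ∈ S R, z ∈ P := by
  intro z hz
  rw [S, LieSubmodule.lie_comm] at hz
  refine lie_sub_le _ _ P (fun x _ w hw => ?_) z hz
  rw [LieSubmodule.lie_comm] at hw
  exact lie_sub_le _ _ (P.comap (LieAlgebra.ad K F x))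
    (fun y _ z hz => h x y z hz) w hw

theorem abelian_part (R : LieIdeal K F) (x y : F) (hx : x ∈ R)
    (hy : y ∈ LieModule.lowerCentralSeries K F F 2) : ⁅x, y⁆ ∈ S R := by
  have h1 : y ∈ LieModule.lowerCentralSeries K F F 1 :=
    LieModule.antitone_lowerCentralSeries K F F (by norm_num) hy
  refine lcs_step 0 ⊤ ((S R).toSubmodule.comap (LieAlgebra.ad K F x))
    (fun _ _ => trivial) (fun u v _ => ?_) y h1
  change ⁅x, ⁅u, v⁆⁆ ∈ S R
  have e : ⁅x, ⁅u, v⁆⁆ = ⁅v, ⁅u, x⁆⁆ - ⁅u, ⁅v, x⁆⁆ := by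
    rw [leibniz_lie x u v, ← lie_skew x u, ← lie_skew x v, ← lie_skew v ⁅u, x⁆, neg_lie, lie_neg,
      sub_eq_add_neg]
  rw [e]
  exact sub_mem (lie_lie_mem_S R _ _ _ hx) (lie_lie_mem_S R _ _ _ hx)
end

section
variable (K)
/-- The free Lie algebra on two generators. -/
abbrev F2 := FreeLieAlgebra K (Fin 2)
/-- first generator -/
noncomputable abbrev a : F2 K := FreeLieAlgebra.of K 0
/-- second generator -/
noncomputable abbrev b : F2 K := FreeLieAlgebra.of K 1
/-- `[a,b]` -/
noncomputable abbrev c : F2 K := ⁅a K, b K⁆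
/-- `[a,c]` -/
noncomputable abbrev d : F2 K := ⁅a K, c K⁆
/-- `[b,c]` -/
noncomputable abbrev r : F2 K := ⁅b K, c K⁆
/-- `[a,d]` -/
noncomputable abbrev p : F2 K := ⁅a K, d K⁆
/-- `[b,d]` -/
noncomputable abbrev q : F2 K := ⁅b K, d K⁆
/-- `[b,r]` -/
noncomputable abbrev s : F2 K := ⁅b K, r K⁆
/-- `[a,p]` -/
noncomputable abbrev t : F2 K := ⁅a K, p K⁆
/-- `[b,p]` -/
noncomputable abbrev u : F2 K := ⁅b K, p K⁆

theorem a_r : ⁅a K, r K⁆ = q K := by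
  rw [leibniz_lie (a K) (b K) (c K)]
  simp

/-- the six representatives -/
noncomputable def e : Fin 6 → F2 K := ![r K, p K, q K, s K, t K, u K]

/-- The Lie hom to the ten-dimensional model. -/
noncomputable def phi : F2 K →ₗ⁅K⁆ Q K :=
  FreeLieAlgebra.lift K ![bv 0, bv 1]

variable {K}

theorem gen_subalg (A : LieSubalgebra K (F2 K)) (ha : a K ∈ A) (hb : b K ∈ A) (x : F2 K) :
    x ∈ A := by
  let f : F2 K →ₗ⁅K⁆ A := FreeLieAlgebra.lift K ![⟨a K, ha⟩, ⟨b K, hb⟩]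
  have h : A.incl.comp f = LieHom.id := by
    apply FreeLieAlgebra.hom_ext
    intro i
    fin_cases i <;> simp [f]
  have h2 : A.incl (f x) = x := by
    rw [← LieHom.comp_apply, h]; rfl
  rw [← h2]
  exact (f x).2

theorem lie_into (U U' : Submodule K (F2 K)) (hle : U' ≤ U)
    (ha : ∀ y ∈ U, ⁅a K, y⁆ ∈ U') (hb : ∀ y ∈ U, ⁅b K, y⁆ ∈ U') :
    ∀ x : F2 K, ∀ y ∈ U, ⁅x, y⁆ ∈ U' := by
  intro x
  let A : LieSubalgebra K (F2 K) :=
    { carrier := {x | ∀ y ∈ U, ⁅x, y⁆ ∈ U'}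
      add_mem' := fun {x x'} hx hx' y hy => by
        rw [add_lie]; exact add_mem (hx y hy) (hx' y hy)
      zero_mem' := fun y _ => by rw [zero_lie]; exact zero_mem _
      smul_mem' := fun k x hx y hy => by
        rw [smul_lie]; exact U'.smul_mem k (hx y hy)
      lie_mem' := fun {x x'} hx hx' y hy => by
        rw [lie_lie]
        exact sub_mem (hx _ (hle (hx' y hy))) (hx' _ (hle (hx y hy))) }
  exact gen_subalg A ha hb x

theorem lie_sup_span (N : LieIdeal K (F2 K)) (X : Set (F2 K)) (x : F2 K)
    (U' : Submodule K (F2 K)) (hN : N.toSubmodule ≤ U') (h : ∀ y ∈ X, ⁅x, y⁆ ∈ U') :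
    ∀ y ∈ N.toSubmodule ⊔ Submodule.span K X, ⁅x, y⁆ ∈ U' := by
  have : N.toSubmodule ⊔ Submodule.span K X ≤ U'.comap (LieAlgebra.ad K (F2 K) x) := by
    apply sup_le
    · intro y hy
      exact hN (N.lie_mem hy)
    · rw [Submodule.span_le]
      exact h
  exact fun y hy => this hy

theorem r_lcs : r K ∈ LieModule.lowerCentralSeries K (F2 K) (F2 K) 2 :=
  lie_mem_lcs 1 _ _ (lie_mem_lcs 0 _ _ (by simp))

theorem d_lcs : d K ∈ LieModule.lowerCentralSeries K (F2 K) (F2 K) 2 :=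
  lie_mem_lcs 1 _ _ (lie_mem_lcs 0 _ _ (by simp))

theorem p_lcs : p K ∈ LieModule.lowerCentralSeries K (F2 K) (F2 K) 3 :=
  lie_mem_lcs 2 _ _ d_lcs

section
variable (R : LieIdeal K (F2 K))

/-- `S R` plus the span of the six representatives -/
noncomputable def T : Submodule K (F2 K) := (S R).toSubmodule ⊔ Submodule.span K (Set.range (e K))

theorem S_le_T : (S R).toSubmodule ≤ T R := le_sup_left

theorem e_mem_T (i : Fin 6) : e K i ∈ T R :=
  (le_sup_right : _ ≤ T R) (Submodule.subset_span ⟨i, rfl⟩)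

theorem T_lie (hr : r K ∈ R)
    (hl : LieModule.lowerCentralSeries K (F2 K) (F2 K) 3 ≤ R) : ∀ x : F2 K, ∀ y ∈ T R, ⁅x, y⁆ ∈ T R := by
  apply lie_into _ _ le_rfl
  · apply lie_sup_span _ _ _ _ (S_le_T R)
    rintro _ ⟨i, rfl⟩
    fin_cases i
    · change ⁅a K, r K⁆ ∈ _
      rw [a_r]; exact e_mem_T R 2
    · exact e_mem_T R 4
    · change ⁅a K, q K⁆ ∈ _
      rw [← a_r]; exact S_le_T R (lie_lie_mem_S R _ _ _ hr)
    · exact S_le_T R (lie_lie_mem_S R _ _ _ hr)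
    · exact S_le_T R (lie_lie_mem_S R _ _ _ (hl p_lcs))
    · exact S_le_T R (lie_lie_mem_S R _ _ _ (hl p_lcs))
  · apply lie_sup_span _ _ _ _ (S_le_T R)
    rintro _ ⟨i, rfl⟩
    fin_cases i
    · exact e_mem_T R 3
    · exact e_mem_T R 5
    · change ⁅b K, q K⁆ ∈ _
      rw [← a_r]; exact S_le_T R (lie_lie_mem_S R _ _ _ hr)
    · exact S_le_T R (lie_lie_mem_S R _ _ _ hr)
    · exact S_le_T R (lie_lie_mem_S R _ _ _ (hl p_lcs))
    · exact S_le_T R (lie_lie_mem_S R _ _ _ (hl p_lcs))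

/-- `T` as an ideal. -/
noncomputable def TI (hr : r K ∈ R)
    (hl : LieModule.lowerCentralSeries K (F2 K) (F2 K) 3 ≤ R) : LieIdeal K (F2 K) := { T R with lie_mem := fun {x y} h => T_lie R hr hl x y h }

theorem lcs3_le_T (hr : r K ∈ R)
    (hl : LieModule.lowerCentralSeries K (F2 K) (F2 K) 3 ≤ R) :
    ∀ z ∈ LieModule.lowerCentralSeries K (F2 K) (F2 K) 3, z ∈ TI R hr hl := by
  set N := TI R hr hl with hN
  have eN : ∀ i, e K i ∈ N := e_mem_T R
  let W1 := N.toSubmodule ⊔ Submodule.span K {a K, b K, c K, d K}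
  let W2 := N.toSubmodule ⊔ Submodule.span K {c K, d K}
  let W3 := N.toSubmodule ⊔ Submodule.span K {d K}
  have h21 : W2 ≤ W1 := sup_le_sup_left (Submodule.span_mono (by
    intro x hx; simp only [Set.mem_insert_iff, Set.mem_singleton_iff] at hx ⊢; tauto)) _
  have h32 : W3 ≤ W2 := sup_le_sup_left (Submodule.span_mono (by
    intro x hx; simp only [Set.mem_insert_iff, Set.mem_singleton_iff] at hx ⊢; tauto)) _
  have n3 : N.toSubmodule ≤ W3 := le_sup_left
  have n2 : N.toSubmodule ≤ W2 := le_sup_left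
  have d3 : d K ∈ W3 := (le_sup_right : _ ≤ W3) (Submodule.subset_span (by simp))
  have c2 : c K ∈ W2 := (le_sup_right : _ ≤ W2) (Submodule.subset_span (by simp))
  have a1 : a K ∈ W1 := (le_sup_right : _ ≤ W1) (Submodule.subset_span (by simp))
  have b1 : b K ∈ W1 := (le_sup_right : _ ≤ W1) (Submodule.subset_span (by simp))
  have L3 : ∀ x : F2 K, ∀ y ∈ W3, ⁅x, y⁆ ∈ N.toSubmodule := by
    apply lie_into _ _ n3
    · apply lie_sup_span _ _ _ _ le_rfl
      rintro _ rfl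
      exact eN 1
    · apply lie_sup_span _ _ _ _ le_rfl
      rintro _ rfl
      exact eN 2
  have L2 : ∀ x : F2 K, ∀ y ∈ W2, ⁅x, y⁆ ∈ W3 := by
    apply lie_into _ _ h32
    · apply lie_sup_span _ _ _ _ n3
      rintro _ (rfl | rfl)
      · exact d3
      · exact n3 (eN 1)
    · apply lie_sup_span _ _ _ _ n3
      rintro _ (rfl | rfl)
      · exact n3 (eN 0)
      · exact n3 (eN 2)
  have L1 : ∀ x : F2 K, ∀ y ∈ W1, ⁅x, y⁆ ∈ W2 := by
    apply lie_into _ _ h21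
    · apply lie_sup_span _ _ _ _ n2
      rintro _ (rfl | rfl | rfl | rfl)
      · rw [lie_self]; exact zero_mem _
      · exact c2
      · exact h32 d3
      · exact n2 (eN 1)
    · apply lie_sup_span _ _ _ _ n2
      rintro _ (rfl | rfl | rfl | rfl)
      · rw [← lie_skew]; exact neg_mem c2
      · rw [lie_self]; exact zero_mem _
      · exact n2 (eN 0)
      · exact n2 (eN 2)
  let A : LieSubalgebra K (F2 K) := { W1 with lie_mem' := fun {x y} _ hy => h21 (L1 x y hy) }
  have top : ∀ x, x ∈ W1 := gen_subalg A a1 b1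
  exact lcs_step 2 W3 _ (lcs_step 1 W2 _ (lcs_step 0 W1 _ (fun x _ => top x) L1) L2) L3

end

/-! ### The map to the model -/

theorem phi_a : phi K (a K) = bv 0 := by simp [phi]
theorem phi_b : phi K (b K) = bv 1 := by simp [phi]
theorem phi_c : phi K (c K) = bv 2 := by
  rw [LieHom.map_lie, phi_a, phi_b]
  apply Q_ext <;> simp [lie_eq, br0, br1, br2, br3, br4, br5, br6, br7, br8, br9, bv_apply]
theorem phi_d : phi K (d K) = bv 3 := by
  rw [LieHom.map_lie, phi_a, phi_c]
  apply Q_ext <;> simp [lie_eq, br0, br1, br2, br3, br4, br5, br6, br7, br8, br9, bv_apply]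
theorem phi_r : phi K (r K) = bv 4 := by
  rw [LieHom.map_lie, phi_b, phi_c]
  apply Q_ext <;> simp [lie_eq, br0, br1, br2, br3, br4, br5, br6, br7, br8, br9, bv_apply]
theorem phi_p : phi K (p K) = bv 5 := by
  rw [LieHom.map_lie, phi_a, phi_d]
  apply Q_ext <;> simp [lie_eq, br0, br1, br2, br3, br4, br5, br6, br7, br8, br9, bv_apply]
theorem phi_q : phi K (q K) = bv 6 := by
  rw [LieHom.map_lie, phi_b, phi_d]
  apply Q_ext <;> simp [lie_eq, br0, br1, br2, br3, br4, br5, br6, br7, br8, br9, bv_apply]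
theorem phi_s : phi K (s K) = bv 7 := by
  rw [LieHom.map_lie, phi_b, phi_r]
  apply Q_ext <;> simp [lie_eq, br0, br1, br2, br3, br4, br5, br6, br7, br8, br9, bv_apply]
theorem phi_t : phi K (t K) = bv 8 := by
  rw [LieHom.map_lie, phi_a, phi_p]
  apply Q_ext <;> simp [lie_eq, br0, br1, br2, br3, br4, br5, br6, br7, br8, br9, bv_apply]
theorem phi_u : phi K (u K) = bv 9 := by
  rw [LieHom.map_lie, phi_b, phi_p]
  apply Q_ext <;> simp [lie_eq, br0, br1, br2, br3, br4, br5, br6, br7, br8, br9, bv_apply]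

theorem phi_lcs3 : ∀ z ∈ LieModule.lowerCentralSeries K (F2 K) (F2 K) 3,
    z ∈ (J (K := K) 4).comap (phi K).toLinearMap := by
  refine lcs_step 2 ((J 3).comap (phi K).toLinearMap) _
    (lcs_step 1 ((J 2).comap (phi K).toLinearMap) _
      (lcs_step 0 ⊤ _ (fun _ _ => trivial) ?_) ?_) ?_
  · intro x y _
    change phi K ⁅x, y⁆ ∈ J (K := K) 2
    rw [LieHom.map_lie]; exact lie_J2 _ _
  · intro x y hy
    change phi K ⁅x, y⁆ ∈ J (K := K) 3
    rw [LieHom.map_lie]; exact lie_J3 _ _ hy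
  · intro x y hy
    change phi K ⁅x, y⁆ ∈ J (K := K) 4
    rw [LieHom.map_lie]; exact lie_J4 _ _ hy

/-- last six coordinates -/
def tail6 : Q K →ₗ[K] (Fin 6 → K) where
  toFun x i := x (Fin.natAdd 4 i)
  map_add' _ _ := rfl
  map_smul' _ _ := rfl

/-- the coordinate map on the free Lie algebra -/
noncomputable def g0 : F2 K →ₗ[K] (Fin 6 → K) := tail6 ∘ₗ (phi K).toLinearMap

theorem g0_e (i : Fin 6) : g0 (e K i) = Pi.single i 1 := by
  have h : ∀ x : F2 K, g0 x = tail6 (phi K x) := fun _ => rfl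
  rw [h]
  funext j
  fin_cases i
  · change phi K (r K) _ = _
    rw [phi_r, bv_apply]; fin_cases j <;> simp
  · change phi K (p K) _ = _
    rw [phi_p, bv_apply]; fin_cases j <;> simp
  · change phi K (q K) _ = _
    rw [phi_q, bv_apply]; fin_cases j <;> simp
  · change phi K (s K) _ = _
    rw [phi_s, bv_apply]; fin_cases j <;> simp
  · change phi K (t K) _ = _
    rw [phi_t, bv_apply]; fin_cases j <;> simp
  · change phi K (u K) _ = _
    rw [phi_u, bv_apply]; fin_cases j <;> simp

theorem g0_sum (k : Fin 6 → K) : g0 (∑ i, k i • e K i) = k := by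
  simp only [map_sum, map_smul, g0_e]
  funext j
  simp [Finset.sum_apply, Pi.single_apply]

end
end TwoNil

theorem stmt (K : Type*) [Field K] [CharZero K]
    (R : LieIdeal K (FreeLieAlgebra K (Fin 2)))
    (hR : R = LieSubmodule.lieSpan K (FreeLieAlgebra K (Fin 2))
        {⁅⁅FreeLieAlgebra.of K (0 : Fin 2), FreeLieAlgebra.of K (1 : Fin 2)⁆,
           FreeLieAlgebra.of K (1 : Fin 2)⁆} ⊔
      LieModule.lowerCentralSeries K (FreeLieAlgebra K (Fin 2)) (FreeLieAlgebra K (Fin 2)) 3) :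
    (∀ x y : FreeLieAlgebra K (Fin 2),
        x ∈ R ⊓ LieModule.lowerCentralSeries K (FreeLieAlgebra K (Fin 2)) (FreeLieAlgebra K (Fin 2)) 2 →
        y ∈ R ⊓ LieModule.lowerCentralSeries K (FreeLieAlgebra K (Fin 2)) (FreeLieAlgebra K (Fin 2)) 2 →
        ⁅x, y⁆ ∈ (⁅⁅R, (⊤ : LieIdeal K (FreeLieAlgebra K (Fin 2)))⁆, (⊤ : LieIdeal K (FreeLieAlgebra K (Fin 2)))⁆ : LieIdeal K (FreeLieAlgebra K (Fin 2)))) ∧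
    FiniteDimensional K (twoNilpotentMultiplier K (FreeLieAlgebra K (Fin 2)) R) ∧
    Module.finrank K (twoNilpotentMultiplier K (FreeLieAlgebra K (Fin 2)) R) = 6 := by
  have e0 : ⁅⁅FreeLieAlgebra.of K (0 : Fin 2), FreeLieAlgebra.of K (1 : Fin 2)⁆,
           FreeLieAlgebra.of K (1 : Fin 2)⁆ = - TwoNil.r K := (lie_skew _ _).symm
  rw [e0] at hR
  have hr : TwoNil.r K ∈ R := by
    have h : - TwoNil.r K ∈ R := by
      rw [hR]
      exact SetLike.le_def.1 le_sup_left (LieSubmodule.subset_lieSpan (Set.mem_singleton _))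
    rw [← neg_neg (TwoNil.r K)]
    exact neg_mem h
  have hl : LieModule.lowerCentralSeries K (FreeLieAlgebra K (Fin 2))
      (FreeLieAlgebra K (Fin 2)) 3 ≤ R := by
    rw [hR]; exact le_sup_right
  have hRT : R ≤ TwoNil.TI R hr hl := by
    conv_lhs => rw [hR]
    refine sup_le ?_ (TwoNil.lcs3_le_T R hr hl)
    rw [LieSubmodule.lieSpan_le, Set.singleton_subset_iff]
    exact neg_mem (TwoNil.e_mem_T R 0)
  have hRI : R ≤ LieIdeal.comap (TwoNil.phi K) TwoNil.I := by
    conv_lhs => rw [hR]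
    refine sup_le ?_ (fun z hz => LieIdeal.mem_comap.2 (TwoNil.phi_lcs3 z hz))
    rw [LieSubmodule.lieSpan_le, Set.singleton_subset_iff]
    refine neg_mem (LieIdeal.mem_comap.2 ?_)
    rw [TwoNil.phi_r]
    intro i hi
    fin_cases i <;> first | rfl | (exfalso; simp at hi; done)
  have hS0 : ∀ z ∈ TwoNil.S R, TwoNil.g0 z = 0 := by
    refine TwoNil.S_le R (LinearMap.ker TwoNil.g0) ?_
    intro x y z hz
    have h : TwoNil.phi K ⁅x, ⁅y, z⁆⁆ = 0 := by
      rw [LieHom.map_lie, LieHom.map_lie]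
      exact TwoNil.lie_lie_I _ _ _ (LieIdeal.mem_comap.1 (hRI hz))
    change TwoNil.tail6 (TwoNil.phi K ⁅x, ⁅y, z⁆⁆) = 0
    rw [h, map_zero]
  have h32 := LieModule.antitone_lowerCentralSeries K (FreeLieAlgebra K (Fin 2))
    (FreeLieAlgebra K (Fin 2)) (show 2 ≤ 3 by norm_num)
  have he : ∀ i, TwoNil.e K i ∈ R ⊓ LieModule.lowerCentralSeries K (FreeLieAlgebra K (Fin 2))
      (FreeLieAlgebra K (Fin 2)) 2 := by
    have h3 : ∀ z ∈ LieModule.lowerCentralSeries K (FreeLieAlgebra K (Fin 2))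
      (FreeLieAlgebra K (Fin 2)) 3, z ∈ R ⊓ LieModule.lowerCentralSeries K
      (FreeLieAlgebra K (Fin 2)) (FreeLieAlgebra K (Fin 2)) 2 := fun z hz => ⟨hl hz, h32 hz⟩
    intro i
    fin_cases i
    · exact ⟨hr, TwoNil.r_lcs⟩
    · exact h3 _ TwoNil.p_lcs
    · exact h3 _ (TwoNil.lie_mem_lcs 2 _ _ TwoNil.d_lcs)
    · exact h3 _ (TwoNil.lie_mem_lcs 2 _ _ TwoNil.r_lcs)
    · exact h3 _ (LieSubmodule.lie_mem _ TwoNil.p_lcs)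
    · exact h3 _ (LieSubmodule.lie_mem _ TwoNil.p_lcs)
  refine ⟨fun x y hx hy => TwoNil.abelian_part R x y hx.1 hy.2, ?_⟩
  let M : Submodule K (FreeLieAlgebra K (Fin 2)) :=
    ((R ⊓ LieModule.lowerCentralSeries K (FreeLieAlgebra K (Fin 2)) (FreeLieAlgebra K (Fin 2)) 2 :
      LieIdeal K (FreeLieAlgebra K (Fin 2))) : Submodule K (FreeLieAlgebra K (Fin 2)))
  let g : M →ₗ[K] (Fin 6 → K) := TwoNil.g0 ∘ₗ M.subtype
  have hsurj : Function.Surjective g := by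
    intro k
    refine ⟨⟨∑ i, k i • TwoNil.e K i, M.sum_mem fun i _ => M.smul_mem _ (he i)⟩, ?_⟩
    exact TwoNil.g0_sum k
  have hker : Submodule.comap M.subtype (TwoNil.S R).toSubmodule = LinearMap.ker g := by
    ext ⟨x, hx⟩
    constructor
    · intro h
      exact hS0 x h
    · intro h
      have h : TwoNil.g0 x = 0 := h
      have hT : x ∈ TwoNil.T R := hRT hx.1
      obtain ⟨y, hy, z, hz, rfl⟩ := Submodule.mem_sup.1 hT
      obtain ⟨k, rfl⟩ := (Submodule.mem_span_range_iff_exists_fun K).1 hz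
      rw [map_add, hS0 y hy, zero_add, TwoNil.g0_sum] at h
      subst h
      change y + _ ∈ TwoNil.S R
      simpa using hy
  let E : twoNilpotentMultiplier K (FreeLieAlgebra K (Fin 2)) R ≃ₗ[K] (Fin 6 → K) :=
    (Submodule.quotEquivOfEq _ _ hker).trans (g.quotKerEquivOfSurjective hsurj)
  exact ⟨Module.Finite.equiv E.symm, by rw [E.finrank_eq]; simp⟩
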